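/- Let Y be a Delone set in ℝ with packing radius r > 0 and covering radius R > 0, let α > 1 be real, and let ψ : ℕ → [0,∞) satisfy ∑_{n=1}^∞ ψ(n) = ∞. Then there exists a constant K > 0 depending only on r and R such that for every pair of real numbers 0 ≤ a < b, the set of x ∈ [a,b) for which there are infinitely many pairs (n, y) ∈ ℕ × Y with |α^n x − y| ≤ ψ(n) has Lebesgue measure at least K(b−a). -/

import Mathlib

open MeasureTheory Set

/-- A second moment lower bound for the measure of a finite union of sets. -/
lemma second_moment_le_measureReal_biUnion {X ι : Type*} [MeasurableSpace X] (μ : Measure X)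
    (s : Finset ι) (A : ι → Set X) (hA : ∀ i ∈ s, MeasurableSet (A i))
    (hfin : ∀ i ∈ s, μ (A i) ≠ ⊤) (t : ℝ) :
    2 * t * ∑ i ∈ s, μ.real (A i) - t ^ 2 * ∑ i ∈ s, ∑ j ∈ s, μ.real (A i ∩ A j)
      ≤ μ.real (⋃ i ∈ s, A i) := by
  classical
  have hU : MeasurableSet (⋃ i ∈ s, A i) := s.measurableSet_biUnion hA
  have hUfin : μ (⋃ i ∈ s, A i) ≠ ⊤ :=
    (measure_biUnion_lt_top s.finite_toSet fun i hi => (hfin i hi).lt_top).ne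
  have int_ind : ∀ B : Set X, MeasurableSet B → μ B ≠ ⊤ →
      Integrable (B.indicator (fun _ => (1 : ℝ))) μ := fun B hB hB' =>
    (integrable_indicator_iff hB).2 (integrableOn_const hB')
  have integral_ind : ∀ B : Set X, MeasurableSet B →
      ∫ x, B.indicator (fun _ => (1 : ℝ)) x ∂μ = μ.real B := fun B hB => by
    simp [integral_indicator hB]
  have hAA : ∀ i ∈ s, ∀ j ∈ s, Integrable ((A i ∩ A j).indicator (fun _ => (1 : ℝ))) μ :=
    fun i hi j hj => int_ind _ ((hA i hi).inter (hA j hj))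
      (measure_ne_top_of_subset inter_subset_left (hfin i hi))
  have h1 : ∫ x, ∑ i ∈ s, (A i).indicator (fun _ => (1 : ℝ)) x ∂μ = ∑ i ∈ s, μ.real (A i) := by
    rw [integral_finsetSum _ fun i hi => int_ind _ (hA i hi) (hfin i hi)]
    exact Finset.sum_congr rfl fun i hi => integral_ind _ (hA i hi)
  have h2 : ∫ x, ∑ i ∈ s, ∑ j ∈ s, (A i ∩ A j).indicator (fun _ => (1 : ℝ)) x ∂μ
      = ∑ i ∈ s, ∑ j ∈ s, μ.real (A i ∩ A j) := by
    rw [integral_finsetSum _ fun i hi => integrable_finsetSum _ (hAA i hi)]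
    refine Finset.sum_congr rfl fun i hi => ?_
    rw [integral_finsetSum _ (hAA i hi)]
    exact Finset.sum_congr rfl fun j hj => integral_ind _ ((hA i hi).inter (hA j hj))
  have i1 : Integrable (fun x => 2 * t * ∑ i ∈ s, (A i).indicator (fun _ => (1 : ℝ)) x) μ :=
    (integrable_finsetSum _ fun i hi => int_ind _ (hA i hi) (hfin i hi)).const_mul _
  have i2 : Integrable (fun x => t ^ 2 * ∑ i ∈ s, ∑ j ∈ s,
      (A i ∩ A j).indicator (fun _ => (1 : ℝ)) x) μ :=
    (integrable_finsetSum _ fun i hi => integrable_finsetSum _ (hAA i hi)).const_mul _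
  rw [← h1, ← h2, ← integral_const_mul, ← integral_const_mul, ← integral_sub i1 i2,
    ← integral_ind _ hU]
  refine integral_mono (i1.sub i2) (int_ind _ hU hUfin) fun x => ?_
  have hsq : ∑ i ∈ s, ∑ j ∈ s, (A i ∩ A j).indicator (fun _ => (1 : ℝ)) x
      = (∑ i ∈ s, (A i).indicator (fun _ => (1 : ℝ)) x) ^ 2 := by
    rw [sq, Finset.sum_mul_sum]
    refine Finset.sum_congr rfl fun i _ => Finset.sum_congr rfl fun j _ => ?_
    by_cases hi : x ∈ A i <;> by_cases hj : x ∈ A j <;> simp [hi, hj]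
  simp only [hsq]
  by_cases hx : x ∈ ⋃ i ∈ s, A i
  · rw [indicator_of_mem hx]
    nlinarith [sq_nonneg (1 - t * ∑ i ∈ s, (A i).indicator (fun _ => (1 : ℝ)) x)]
  · rw [indicator_of_notMem hx]
    have : ∑ i ∈ s, (A i).indicator (fun _ => (1 : ℝ)) x = 0 :=
      Finset.sum_eq_zero fun i hi => indicator_of_notMem
        (fun h => hx (mem_biUnion (Finset.mem_coe.2 hi) h)) _
    simp [this]

/-- A finite `2 * r`-separated subset of `[c, d]` has at most `(d - c) / (2 * r) + 1` points. -/
lemma card_mul_le_of_separated {r c d : ℝ} (hcd : c ≤ d) (hr : 0 < r) (F : Finset ℝ)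
    (hsep : ∀ y ∈ F, ∀ y' ∈ F, y ≠ y' → 2 * r ≤ |y - y'|) (hF : ∀ y ∈ F, y ∈ Icc c d) :
    2 * r * F.card ≤ d - c + 2 * r := by
  have hdisj : (F : Set ℝ).PairwiseDisjoint fun y => Ico (y - r) (y + r) := by
    intro y hy z hz hyz
    refine Set.disjoint_left.2 fun x hx hx' => ?_
    have := hsep y hy z hz hyz
    simp only [mem_Ico] at hx hx'
    rcases le_abs.1 this with h | h <;> linarith [hx.1, hx.2, hx'.1, hx'.2]
  have h1 : volume.real (⋃ y ∈ F, Ico (y - r) (y + r)) = 2 * r * F.card := by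
    rw [measureReal_biUnion_finset hdisj (fun _ _ => measurableSet_Ico)
      (fun _ _ => measure_Ico_lt_top.ne)]
    rw [Finset.sum_congr rfl (fun y _ => Real.volume_real_Ico_of_le (by linarith)),
      Finset.sum_congr rfl (fun y _ => show y + r - (y - r) = 2 * r by ring)]
    simp [mul_comm]
  have h2 : (⋃ y ∈ F, Ico (y - r) (y + r)) ⊆ Icc (c - r) (d + r) := by
    refine iUnion₂_subset fun y hy x hx => ?_
    have := hF y hy
    simp only [mem_Icc, mem_Ico] at *
    constructor <;> linarith [this.1, this.2, hx.1, hx.2]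
  have h3 := measureReal_mono (μ := volume) h2 measure_Icc_lt_top.ne
  rw [h1, Real.volume_real_Icc_of_le (by linarith)] at h3
  linarith

/-- A `2 * r`-separated set meets every compact interval in a finite set. -/
lemma finite_inter_Icc_of_separated {r : ℝ} (hr : 0 < r) {Y : Set ℝ}
    (hsep : ∀ y ∈ Y, ∀ y' ∈ Y, y ≠ y' → 2 * r ≤ |y - y'|) (c d : ℝ) :
    (Y ∩ Icc c d).Finite := by
  rcases lt_or_ge d c with hcd | hcd
  · simp [Icc_eq_empty_of_lt hcd]
  by_contra hinf
  obtain ⟨k, hk⟩ := exists_nat_gt ((d - c + 2 * r) / (2 * r))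
  obtain ⟨F, hFs, hFc⟩ := Set.Infinite.exists_subset_card_eq hinf k
  have := card_mul_le_of_separated hcd hr F
    (fun y hy y' hy' => hsep y (hFs hy).1 y' (hFs hy').1) (fun y hy => (hFs hy).2)
  rw [div_lt_iff₀ (by linarith), ← hFc] at hk
  linarith

/-- If every point of `ℝ` is within `R` of `Y`, then `[c, d]` contains at least
`(d - c) / (2 * R) - 1` points of `Y`. -/
lemma le_card_mul_of_covering {R c d : ℝ} (hR : 0 ≤ R) {Y : Set ℝ}
    (hcov : ∀ x : ℝ, ∃ y ∈ Y, |x - y| ≤ R) (F : Finset ℝ)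
    (hF : ∀ y ∈ Y, y ∈ Icc c d → y ∈ F) :
    d - c - 2 * R ≤ 2 * R * F.card := by
  have hsub : Icc (c + R) (d - R) ⊆ ⋃ y ∈ F, Icc (y - R) (y + R) := by
    intro x hx
    obtain ⟨y, hy, hxy⟩ := hcov x
    rw [abs_le] at hxy
    refine mem_biUnion (hF y hy ⟨?_, ?_⟩) ⟨?_, ?_⟩ <;> linarith [hx.1, hx.2]
  have h1 := measureReal_mono (μ := volume) hsub
    (measure_biUnion_lt_top F.finite_toSet fun _ _ => measure_Icc_lt_top).ne
  have h2 := h1.trans (measureReal_biUnion_finset_le F _)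
  rw [Finset.sum_congr rfl (fun y _ => Real.volume_real_Icc_of_le (by linarith)),
    Finset.sum_congr rfl (fun y _ => show y + R - (y - R) = 2 * R by ring), Real.volume_real_Icc]
    at h2
  have h3 := (le_max_left _ _).trans h2
  simp only [Finset.sum_const, nsmul_eq_mul] at h3
  linarith

/-- Truncating a nonnegative non-summable sequence at a positive level keeps it non-summable. -/
lemma not_summable_min_const {ψ : ℕ → ℝ} (hψ : ¬ Summable ψ) {r : ℝ} (hr : 0 < r) :
    ¬ Summable fun n => min (ψ n) r := by
  intro h
  refine hψ ((summable_congr_atTop ?_).1 h)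
  filter_upwards [h.tendsto_atTop_zero.eventually_lt_const hr] with n hn
  exact min_eq_left ((min_lt_iff.1 hn).resolve_right (lt_irrefl r)).le

/-- The interval of those `x` with `|α ^ n * x - y| ≤ ρ`. -/
def dilateInterval (α ρ : ℝ) (n : ℕ) (y : ℝ) : Set ℝ :=
  Icc ((y - ρ) / α ^ n) ((y + ρ) / α ^ n)

lemma mem_dilateInterval {α ρ : ℝ} (hα : 0 < α) {n : ℕ} {x y : ℝ} :
    x ∈ dilateInterval α ρ n y ↔ |α ^ n * x - y| ≤ ρ := by
  have := pow_pos hα n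
  rw [dilateInterval, mem_Icc, div_le_iff₀ this, le_div_iff₀ this, abs_le]
  constructor <;> rintro ⟨h, h'⟩ <;> constructor <;> linarith

lemma volume_real_dilateInterval {α ρ : ℝ} (hα : 0 < α) (hρ : 0 ≤ ρ) (n : ℕ) (y : ℝ) :
    volume.real (dilateInterval α ρ n y) = 2 * ρ / α ^ n := by
  have := pow_pos hα n
  rw [dilateInterval, Real.volume_real_Icc_of_le (by gcongr; linarith)]
  ring

/-- The total overlap of one interval of level `m` with separated intervals of level `n ≥ m`. -/
lemma sum_volume_inter_dilateInterval_le {r α : ℝ} (hr : 0 < r) (hα : 1 < α) {φ : ℕ → ℝ}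
    (hφ : ∀ n, 0 ≤ φ n) (hφr : ∀ n, φ n ≤ r) {m n : ℕ} (hmn : m ≤ n) (y : ℝ) (F : Finset ℝ)
    (hsep : ∀ y ∈ F, ∀ y' ∈ F, y ≠ y' → 2 * r ≤ |y - y'|) :
    ∑ z ∈ F, volume.real (dilateInterval α (φ m) m y ∩ dilateInterval α (φ n) n z)
      ≤ (2 + α ^ (n - m) * φ m / r) * (2 * φ n / α ^ n) := by
  classical
  have hα0 : 0 < α := by linarith
  set G := F.filter fun z => (dilateInterval α (φ m) m y ∩ dilateInterval α (φ n) n z).Nonempty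
  have hq : 0 ≤ α ^ (n - m) := by positivity
  have hcard : 2 * r * G.card ≤ 2 * (φ n + α ^ (n - m) * φ m) + 2 * r := by
    have := card_mul_le_of_separated (c := α ^ (n - m) * y - (φ n + α ^ (n - m) * φ m))
      (d := α ^ (n - m) * y + (φ n + α ^ (n - m) * φ m))
      (by linarith [hφ n, mul_nonneg hq (hφ m)]) hr G
      (fun z hz z' hz' => hsep z (Finset.mem_filter.1 hz).1 z' (Finset.mem_filter.1 hz').1) ?_
    · linarith
    · intro z hz
      obtain ⟨x, hx, hx'⟩ := (Finset.mem_filter.1 hz).2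
      rw [mem_dilateInterval hα0, abs_le] at hx hx'
      have e : α ^ n = α ^ (n - m) * α ^ m := by rw [← pow_add]; congr 1; omega
      rw [e] at hx'
      have h1 := mul_le_mul_of_nonneg_left hx.1 hq
      have h2 := mul_le_mul_of_nonneg_left hx.2 hq
      constructor <;> nlinarith [hx'.1, hx'.2]
  have hcard' : (G.card : ℝ) ≤ 2 + α ^ (n - m) * φ m / r := by
    have : α ^ (n - m) * φ m = α ^ (n - m) * φ m / r * r := by field_simp
    rw [this] at hcard
    nlinarith [hφr n]
  have hpos : 0 ≤ 2 * φ n / α ^ n := by have := hφ n; positivity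
  calc ∑ z ∈ F, volume.real (dilateInterval α (φ m) m y ∩ dilateInterval α (φ n) n z)
      = ∑ z ∈ G, volume.real (dilateInterval α (φ m) m y ∩ dilateInterval α (φ n) n z) := by
        refine (Finset.sum_subset (Finset.filter_subset _ _) fun z hz hz' => ?_).symm
        have : dilateInterval α (φ m) m y ∩ dilateInterval α (φ n) n z = ∅ := by
          by_contra h
          exact hz' (Finset.mem_filter.2 ⟨hz, nonempty_iff_ne_empty.2 h⟩)
        simp [this]
    _ ≤ ∑ z ∈ G, 2 * φ n / α ^ n := by
        refine Finset.sum_le_sum fun z _ => ?_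
        rw [← volume_real_dilateInterval hα0 (hφ n) n z]
        exact measureReal_mono inter_subset_right measure_Icc_lt_top.ne
    _ = G.card * (2 * φ n / α ^ n) := by simp
    _ ≤ _ := by gcongr

/-- Weights decaying geometrically below the diagonal have uniformly bounded column sums. -/
lemma sum_ite_inv_pow_le {α : ℝ} (hα : 1 < α) (s : Finset ℕ) (n : ℕ) :
    ∑ m ∈ s, (if m ≤ n then (α⁻¹) ^ (n - m) else 0) ≤ (1 - α⁻¹)⁻¹ := by
  have h0 : 0 ≤ α⁻¹ := by positivity
  have h1 : α⁻¹ < 1 := inv_lt_one_of_one_lt₀ hα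
  calc ∑ m ∈ s, (if m ≤ n then (α⁻¹) ^ (n - m) else 0)
      = ∑ m ∈ s with m ≤ n, (α⁻¹) ^ (n - m) := by rw [Finset.sum_filter]
    _ ≤ ∑ m ∈ Finset.range (n + 1), (α⁻¹) ^ (n - m) := by
        refine Finset.sum_le_sum_of_subset_of_nonneg (fun m hm => ?_) fun _ _ _ => by positivity
        have := (Finset.mem_filter.1 hm).2
        simp; omega
    _ = ∑ k ∈ Finset.range (n + 1), (α⁻¹) ^ k := by
        simpa using Finset.sum_range_reflect (fun k => (α⁻¹) ^ k) (n + 1)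
    _ ≤ ∑' k, (α⁻¹) ^ k :=
        (summable_geometric_of_lt_one h0 h1).sum_le_tsum _ fun _ _ => by positivity
    _ = _ := tsum_geometric_of_lt_one h0 h1

/-- Lower bound for the measure of a finite union of dilated intervals with large total weight. -/
lemma le_volume_biUnion_dilateInterval {r R α L : ℝ} (hr : 0 < r) (hR : 0 < R) (hα : 1 < α)
    (hL : 0 < L) {φ : ℕ → ℝ} (hφ : ∀ n, 0 ≤ φ n) (hφr : ∀ n, φ n ≤ r) (F : ℕ → Finset ℝ)
    (hsep : ∀ n, ∀ y ∈ F n, ∀ y' ∈ F n, y ≠ y' → 2 * r ≤ |y - y'|) (s : Finset ℕ)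
    (hlow : ∀ n ∈ s, α ^ n * L ≤ 4 * R * (F n).card)
    (hupp : ∀ n ∈ s, 2 * r * (F n).card ≤ α ^ n * L)
    (hS : 4 * r * (1 - α⁻¹)⁻¹ ≤ ∑ n ∈ s, φ n) :
    r ^ 2 / (8 * R ^ 2) * L
      ≤ volume.real (⋃ p ∈ s.sigma F, dilateInterval α (φ p.1) p.1 p.2) := by
  have hα0 : 0 < α := by linarith
  set S := ∑ n ∈ s, φ n
  set Q := (1 - α⁻¹)⁻¹
  have hQ : 0 < Q := inv_pos.2 (sub_pos.2 (inv_lt_one_of_one_lt₀ hα))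
  have hSpos : 0 < S := lt_of_lt_of_le (by positivity) hS
  set V : ℕ → ℕ → ℝ := fun m n => ∑ y ∈ F m, ∑ z ∈ F n,
    volume.real (dilateInterval α (φ m) m y ∩ dilateInterval α (φ n) n z) with hV
  set w : ℕ → ℕ → ℝ := fun m n => if m ≤ n then (α⁻¹) ^ (n - m) else 0 with hw
  have hw0 : ∀ m n, 0 ≤ w m n := fun m n => by simp only [hw]; split_ifs <;> positivity
  have hVsymm : ∀ m n, V m n = V n m := fun m n => by
    simp only [hV]
    rw [Finset.sum_comm]
    simp only [inter_comm]
  have hVle : ∀ m ∈ s, ∀ n, m ≤ n →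
      V m n ≤ L / r ^ 2 * (φ m * φ n) + 2 * L / r * (w m n * φ n) := by
    intro m hm n hmn
    have hfac : 0 ≤ (2 + α ^ (n - m) * φ m / r) * (2 * φ n / α ^ n) := by
      have := hφ m; have := hφ n; positivity
    have hc : ((F m).card : ℝ) ≤ α ^ m * L / (2 * r) := by
      rw [le_div_iff₀ (by positivity)]; linarith [hupp m hm]
    calc V m n ≤ ∑ y ∈ F m, (2 + α ^ (n - m) * φ m / r) * (2 * φ n / α ^ n) :=
          Finset.sum_le_sum fun y _ =>
            sum_volume_inter_dilateInterval_le hr hα hφ hφr hmn y (F n) (hsep n)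
      _ = (F m).card * ((2 + α ^ (n - m) * φ m / r) * (2 * φ n / α ^ n)) := by simp
      _ ≤ α ^ m * L / (2 * r) * ((2 + α ^ (n - m) * φ m / r) * (2 * φ n / α ^ n)) := by gcongr
      _ = _ := by
        have e : α ^ n = α ^ (n - m) * α ^ m := by rw [← pow_add]; congr 1; omega
        simp only [hw, if_pos hmn, e, inv_pow]
        field_simp
        ring
  have hVle' : ∀ m ∈ s, ∀ n ∈ s, V m n
      ≤ L / r ^ 2 * (φ m * φ n) + 2 * L / r * (w m n * φ n) + 2 * L / r * (w n m * φ m) := by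
    intro m hm n hn
    have p1 : 0 ≤ 2 * L / r * (w m n * φ n) := by have := hw0 m n; have := hφ n; positivity
    have p2 : 0 ≤ 2 * L / r * (w n m * φ m) := by have := hw0 n m; have := hφ m; positivity
    rcases le_total m n with h | h
    · linarith [hVle m hm n h]
    · rw [hVsymm]
      linarith [hVle n hn m h, mul_comm (φ m) (φ n)]
  have hw_sum : ∑ n ∈ s, ∑ m ∈ s, w m n * φ n ≤ Q * S := by
    rw [Finset.mul_sum]
    refine Finset.sum_le_sum fun n _ => ?_
    rw [← Finset.sum_mul]
    exact mul_le_mul_of_nonneg_right (sum_ite_inv_pow_le hα s n) (hφ n)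
  have hsecond : ∑ m ∈ s, ∑ n ∈ s, V m n ≤ 2 * L / r ^ 2 * S ^ 2 := by
    calc ∑ m ∈ s, ∑ n ∈ s, V m n
        ≤ ∑ m ∈ s, ∑ n ∈ s, (L / r ^ 2 * (φ m * φ n) + 2 * L / r * (w m n * φ n)
            + 2 * L / r * (w n m * φ m)) :=
          Finset.sum_le_sum fun m hm => Finset.sum_le_sum fun n hn => hVle' m hm n hn
      _ = L / r ^ 2 * (S * S) + 2 * L / r * (∑ n ∈ s, ∑ m ∈ s, w m n * φ n)
            + 2 * L / r * (∑ n ∈ s, ∑ m ∈ s, w m n * φ n) := by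
          simp only [Finset.sum_add_distrib, ← Finset.mul_sum]
          rw [Finset.sum_comm (f := fun m n => w m n * φ n)]
          simp only [S, ← Finset.sum_mul]
      _ ≤ L / r ^ 2 * (S * S) + 2 * L / r * (Q * S) + 2 * L / r * (Q * S) := by gcongr
      _ = L / r ^ 2 * (S * S) + L / r ^ 2 * ((4 * r * Q) * S) := by field_simp; ring
      _ ≤ L / r ^ 2 * (S * S) + L / r ^ 2 * (S * S) := by gcongr
      _ = _ := by ring
  have hfirst : L / (2 * R) * S ≤
      ∑ n ∈ s, ∑ y ∈ F n, volume.real (dilateInterval α (φ n) n y) := by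
    rw [Finset.mul_sum]
    refine Finset.sum_le_sum fun n hn => ?_
    simp only [volume_real_dilateInterval hα0 (hφ n), Finset.sum_const, nsmul_eq_mul]
    have hp := pow_pos hα0 n
    have hc : α ^ n * L / (4 * R) ≤ (F n).card := by
      rw [div_le_iff₀ (by positivity)]; linarith [hlow n hn]
    have hnn : 0 ≤ 2 * φ n / α ^ n := by have := hφ n; positivity
    calc L / (2 * R) * φ n = α ^ n * L / (4 * R) * (2 * φ n / α ^ n) := by field_simp; ring
      _ ≤ _ := by gcongr
  have key := second_moment_le_measureReal_biUnion volume (s.sigma F)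
    (fun p => dilateInterval α (φ p.1) p.1 p.2) (fun _ _ => measurableSet_Icc)
    (fun _ _ => measure_Icc_lt_top.ne) (r ^ 2 / (4 * R) / S)
  have e2 : ∑ p ∈ s.sigma F, ∑ q ∈ s.sigma F, volume.real
      (dilateInterval α (φ p.1) p.1 p.2 ∩ dilateInterval α (φ q.1) q.1 q.2)
      = ∑ m ∈ s, ∑ n ∈ s, V m n := by
    rw [Finset.sum_sigma]
    refine Finset.sum_congr rfl fun m _ => ?_
    simp only [Finset.sum_sigma, hV]
    exact Finset.sum_comm
  rw [e2, Finset.sum_sigma] at key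
  refine le_trans ?_ key
  set t := r ^ 2 / (4 * R) / S with ht
  have htpos : 0 ≤ t := by positivity
  calc r ^ 2 / (8 * R ^ 2) * L
      = 2 * t * (L / (2 * R) * S) - t ^ 2 * (2 * L / r ^ 2 * S ^ 2) := by
        rw [ht]; field_simp; ring
    _ ≤ _ := by gcongr

/-- For every `r, R > 0` there is a constant `K > 0` (depending only on `r` and `R`)
such that for every Delone set `Y` with these radii, every `α > 1` and every
nonnegative `ψ` with divergent series, and every `0 ≤ a < b`, the set of `x ∈ [a,b)`
admitting infinitely many pairs `(n, y) ∈ ℕ × Y` with `|α^n x - y| ≤ ψ n` has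
Lebesgue measure at least `K (b-a)`. -/
theorem limsup_set_positive_measure
    (r R : ℝ) (hr : 0 < r) (hR : 0 < R) :
    ∃ K : ℝ, 0 < K ∧
      ∀ (Y : Set ℝ),
        (∀ y ∈ Y, ∀ y' ∈ Y, y ≠ y' → 2 * r ≤ |y - y'|) →
        (∀ x : ℝ, ∃ y ∈ Y, |x - y| ≤ R) →
        ∀ (α : ℝ), 1 < α →
        ∀ (ψ : ℕ → ℝ), (∀ n, 0 ≤ ψ n) → ¬ Summable ψ →
        ∀ (a b : ℝ), 0 ≤ a → a < b →
          ENNReal.ofReal (K * (b - a))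
            ≤ volume {x | x ∈ Ico a b ∧
                {p : ℕ × ℝ | p.2 ∈ Y ∧ |α ^ p.1 * x - p.2| ≤ ψ p.1}.Infinite} := by
  refine ⟨r ^ 2 / (8 * R ^ 2), by positivity, ?_⟩
  intro Y hsep hcov α hα ψ hψ hψsum a b _ hab
  have hα0 : 0 < α := by linarith
  have hL : 0 < b - a := sub_pos.2 hab
  set φ : ℕ → ℝ := fun n => min (ψ n) r with hφdef
  have hφ : ∀ n, 0 ≤ φ n := fun n => le_min (hψ n) hr.le
  have hφr : ∀ n, φ n ≤ r := fun n => min_le_right _ _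
  have hfin := fun n : ℕ =>
    finite_inter_Icc_of_separated hr hsep (α ^ n * a + r) (α ^ n * b - 2 * r)
  set F : ℕ → Finset ℝ := fun n => (hfin n).toFinset with hF
  have hFmem : ∀ n y, y ∈ F n ↔ y ∈ Y ∧ y ∈ Icc (α ^ n * a + r) (α ^ n * b - 2 * r) :=
    fun n y => by simp [hF]
  have hFsep : ∀ n, ∀ y ∈ F n, ∀ y' ∈ F n, y ≠ y' → 2 * r ≤ |y - y'| := fun n y hy y' hy' =>
    hsep y ((hFmem n y).1 hy).1 y' ((hFmem n y').1 hy').1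
  obtain ⟨M₀, hM₀⟩ : ∃ M₀ : ℕ, ∀ n ≥ M₀, 6 * r + 4 * R ≤ α ^ n * (b - a) :=
    Filter.eventually_atTop.1 (((tendsto_pow_atTop_atTop_of_one_lt hα).atTop_mul_const
      hL).eventually_ge_atTop _)
  set V : ℕ → Set ℝ := fun M => ⋃ n ≥ M, ⋃ y ∈ F n, dilateInterval α (φ n) n y with hVdef
  have hVmeas : ∀ M, MeasurableSet (V M) := fun M =>
    MeasurableSet.iUnion fun n => MeasurableSet.iUnion fun _ =>
      (F n).measurableSet_biUnion fun _ _ => measurableSet_Icc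
  have hVmem : ∀ M x, x ∈ V M ↔ ∃ n ≥ M, ∃ y ∈ F n, |α ^ n * x - y| ≤ φ n := fun M x => by
    simp only [hVdef, mem_iUnion, mem_dilateInterval hα0, exists_prop]
  have hVanti : Antitone V := fun M M' h x hx => by
    rw [hVmem] at hx ⊢
    obtain ⟨n, hn, H⟩ := hx
    exact ⟨n, h.trans hn, H⟩
  have hVsub : ∀ M, V M ⊆ Ico a b := fun M x hx => by
    obtain ⟨n, -, y, hy, hxy⟩ := (hVmem M x).1 hx
    have hy := ((hFmem n y).1 hy).2
    have hxy := abs_le.1 (hxy.trans (hφr n))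
    have hp := pow_pos hα0 n
    exact ⟨le_of_mul_le_mul_left (by linarith [hy.1, hxy.1]) hp,
      lt_of_mul_lt_mul_left (by linarith [hy.2, hxy.2]) hp.le⟩
  have hVfin : ∀ M, volume (V M) ≠ ⊤ := fun M =>
    measure_ne_top_of_subset (hVsub M) measure_Ico_lt_top.ne
  have hVlow : ∀ M, ENNReal.ofReal (r ^ 2 / (8 * R ^ 2) * (b - a)) ≤ volume (V M) := by
    intro M
    have hdiv := (not_summable_iff_tendsto_nat_atTop_of_nonneg hφ).1
      (not_summable_min_const hψsum hr)
    obtain ⟨N, hN, hMN⟩ := ((hdiv.eventually_ge_atTop (4 * r * (1 - α⁻¹)⁻¹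
      + ∑ i ∈ Finset.range (max M M₀), φ i)).and
        (Filter.eventually_ge_atTop (max M M₀))).exists
    have hS : 4 * r * (1 - α⁻¹)⁻¹ ≤ ∑ n ∈ Finset.Ico (max M M₀) N, φ n := by
      rw [Finset.sum_Ico_eq_sub _ hMN]
      linarith
    have hmain := le_volume_biUnion_dilateInterval hr hR hα hL hφ hφr F hFsep
      (Finset.Ico (max M M₀) N) (fun n hn => ?_) (fun n hn => ?_) hS
    · rw [ENNReal.ofReal_le_iff_le_toReal (hVfin M)]
      refine hmain.trans (measureReal_mono (fun x hx => ?_) (hVfin M))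
      simp only [mem_iUnion, Finset.mem_sigma, Finset.mem_Ico, exists_prop,
        mem_dilateInterval hα0] at hx
      obtain ⟨p, ⟨⟨hn, -⟩, hy⟩, hxy⟩ := hx
      exact (hVmem M x).2 ⟨p.1, (le_max_left _ _).trans hn, p.2, hy, hxy⟩
    · have h := hM₀ n ((le_max_right _ _).trans (Finset.mem_Ico.1 hn).1)
      have := le_card_mul_of_covering hR.le hcov (F n) fun y hy hy' => (hFmem n y).2 ⟨hy, hy'⟩
      linarith
    · have h := hM₀ n ((le_max_right _ _).trans (Finset.mem_Ico.1 hn).1)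
      have := card_mul_le_of_separated (by linarith) hr (F n) (hFsep n)
        fun y hy => ((hFmem n y).1 hy).2
      linarith
  calc ENNReal.ofReal (r ^ 2 / (8 * R ^ 2) * (b - a)) ≤ ⨅ M, volume (V M) := le_iInf hVlow
    _ = volume (⋂ M, V M) :=
        (hVanti.measure_iInter (fun M => (hVmeas M).nullMeasurableSet) ⟨0, hVfin 0⟩).symm
    _ ≤ _ := by
        refine measure_mono fun x hx => ⟨hVsub 0 (mem_iInter.1 hx 0), ?_⟩
        refine Infinite.of_image Prod.fst (infinite_of_forall_exists_gt fun M => ?_)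
        obtain ⟨n, hn, y, hy, hxy⟩ := (hVmem _ x).1 (mem_iInter.1 hx (M + 1))
        exact ⟨n, ⟨(n, y), ⟨((hFmem n y).1 hy).1, hxy.trans (min_le_left _ _)⟩, rfl⟩, hn⟩
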